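/- Let X be a complex Banach space with the approximation property; let A and B be generators of C₀-semigroups T_A and T_B on X which are holomorphic in the half plane {Re(z) > 0} and satisfy ‖T_A(z)‖ ≤ M and ‖T_B(z)‖ ≤ M for Re(z) > 0, with A − B nuclear; let ψ ∈ 𝒯₁ with ψ′(−0) ≠ ∞, and let ξ be the associated tempered distribution supported in ℝ₊ (the Laplace transform of ξ being z ↦ tr((T_A(z) − T_B(z))/z)). If in addition the function t ↦ ψ′(−t) belongs to the test-function space 𝒮_{ℝ₊}, then tr(ψ(A) − ψ(B)) = ⟨ξ(t), ψ′(−t)⟩. -/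

import Mathlib

open MeasureTheory Complex ContinuousLinearMap

noncomputable section

variable {X : Type*} [NormedAddCommGroup X] [NormedSpace ℂ X] [CompleteSpace X]

/-- A Banach space `X` has the approximation property if the identity can be
approximated, uniformly on compact sets, by finite rank (bounded) operators. -/
def ApproxProperty (X : Type*) [NormedAddCommGroup X] [NormedSpace ℂ X] : Prop :=
  ∀ K : Set X, IsCompact K → ∀ ε > (0 : ℝ), ∃ F : X →L[ℂ] X,
    FiniteDimensional ℂ (LinearMap.range (F : X →ₗ[ℂ] X)) ∧ ∀ x ∈ K, ‖F x - x‖ ≤ ε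

/-- A bounded operator on `X` is nuclear (belongs to `𝔖₁`) if it admits a
representation `S x = ∑ₖ fₖ(x) yₖ` with `∑ₖ ‖fₖ‖ ‖yₖ‖ < ∞`. -/
def IsNuclear (S : X →L[ℂ] X) : Prop :=
  ∃ (f : ℕ → (X →L[ℂ] ℂ)) (y : ℕ → X),
    Summable (fun k => ‖f k‖ * ‖y k‖) ∧ ∀ x : X, HasSum (fun k => f k x • y k) (S x)

/-- The nuclear norm `‖S‖_{𝔖₁}`: the infimum of `∑ₖ ‖fₖ‖ ‖yₖ‖` over all nuclear
representations of `S`. -/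
def nuclearNorm (S : X →L[ℂ] X) : ℝ :=
  sInf {c : ℝ | ∃ (f : ℕ → (X →L[ℂ] ℂ)) (y : ℕ → X),
    (∀ x : X, HasSum (fun k => f k x • y k) (S x)) ∧ HasSum (fun k => ‖f k‖ * ‖y k‖) c}

/-- The generator of a `C₀`-semigroup on `X` which is holomorphic in the half plane
`{Re z > 0}`, bundled with the semigroup, its domain and its action (extended by `0`
outside of the domain). -/
structure HoloGen (X : Type*) [NormedAddCommGroup X] [NormedSpace ℂ X] where
  T : ℂ → X →L[ℂ] X
  T_zero : T 0 = 1
  T_add_pos : ∀ ⦃z w : ℂ⦄, 0 < z.re → 0 < w.re → T (z + w) = (T z).comp (T w)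
  T_add_real : ∀ ⦃s t : ℝ⦄, 0 ≤ s → 0 ≤ t →
    T ((s + t : ℝ) : ℂ) = (T (s : ℂ)).comp (T (t : ℂ))
  holo : DifferentiableOn ℂ T {z : ℂ | 0 < z.re}
  strong_cont : ∀ x : X, ContinuousOn (fun t : ℝ => T (t : ℂ) x) (Set.Ici 0)
  dom : Submodule ℂ X
  gen : X → X
  mem_dom_iff : ∀ x : X, x ∈ dom ↔ ∃ y : X,
    Filter.Tendsto (fun t : ℝ => (t : ℂ)⁻¹ • (T (t : ℂ) x - x))
      (nhdsWithin 0 (Set.Ioi 0)) (nhds y)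
  gen_spec : ∀ x ∈ dom,
    Filter.Tendsto (fun t : ℝ => (t : ℂ)⁻¹ • (T (t : ℂ) x - x))
      (nhdsWithin 0 (Set.Ioi 0)) (nhds (gen x))
  gen_zero : ∀ x, x ∉ dom → gen x = 0

/-- The test space `𝒮_{ℝ₊}` of smooth functions `φ` on the half line with all
seminorms `‖φ‖_{j,m} = sup_{t ≥ 0} t^m |φ^{(j)}(t)|` finite (modeled by smooth
functions on `ℝ`; only the restriction to `ℝ₊` matters). -/
def TestSet : Set (ℝ → ℂ) :=
  {φ | ContDiff ℝ (⊤ : ℕ∞) φ ∧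
    ∀ j m : ℕ, ∃ C : ℝ, ∀ t : ℝ, 0 ≤ t → t ^ m * ‖iteratedDeriv j φ t‖ ≤ C}

/-- The seminorm `‖φ‖_{j,m} = sup_{t ≥ 0} t^m |φ^{(j)}(t)|` on `𝒮_{ℝ₊}`. -/
def sNorm (j m : ℕ) (φ : ℝ → ℂ) : ℝ :=
  sInf {C : ℝ | ∀ t : ℝ, 0 ≤ t → t ^ m * ‖iteratedDeriv j φ t‖ ≤ C}

/-- A tempered distribution supported in `ℝ₊`, identified (as in the paper) with a
linear functional on the test space `𝒮_{ℝ₊}` which is continuous with respect to the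
seminorms `‖·‖_{j,m}`. -/
def IsTemperedDistRplus (ξ : (ℝ → ℂ) → ℂ) : Prop :=
  (∀ φ₁ ∈ TestSet, ∀ φ₂ ∈ TestSet, ξ (φ₁ + φ₂) = ξ φ₁ + ξ φ₂) ∧
  (∀ (c : ℂ), ∀ φ ∈ TestSet, ξ (c • φ) = c * ξ φ) ∧
  ∃ (k : ℕ) (C : ℝ), ∀ φ ∈ TestSet,
    ‖ξ φ‖ ≤ C * ∑ j ∈ Finset.range (k + 1), ∑ m ∈ Finset.range (k + 1), sNorm j m φ

/-- The Livschits–Kreĭn trace formula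
`tr(ψ(A) - ψ(B)) = ∫_{(0,∞)} ⟨ξ(t), e^{-ut}⟩ u dμ(u)` holds for every `ψ ∈ 𝒯₁`
with representing measure `μ` and `ψ'(-0) ≠ ∞`; here `D = ψ(A) - ψ(B)` is the
bounded operator extending `x ↦ ∫ (T_A(u) - T_B(u))x dμ(u)` from `D(A)`. -/
def TraceFormulaHolds (tr : (X →L[ℂ] X) → ℂ) (A B : HoloGen X)
    (ξ : (ℝ → ℂ) → ℂ) : Prop :=
  ∀ μ : Measure ℝ, μ {v : ℝ | v ≤ 0} = 0 →
    (∀ s : ℝ, s < 0 → Integrable (fun v => Real.exp (s * v) - 1) μ) →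
    Integrable (fun v => v) μ →
    ∀ D : X →L[ℂ] X,
      (∀ x ∈ A.dom, D x = ∫ u, (A.T (u : ℂ) x - B.T (u : ℂ) x) ∂μ) →
      tr D = ∫ u, ξ (fun t => Complex.exp (-((u : ℂ) * (t : ℂ)))) * (u : ℂ) ∂μ


set_option linter.unusedSectionVars false

/-! ### Nuclear operators as a Banach space -/

def NucRep (S : X →L[ℂ] X) (c : ℝ) : Prop :=
  ∃ (f : ℕ → (X →L[ℂ] ℂ)) (y : ℕ → X),
    (∀ x : X, HasSum (fun k => f k x • y k) (S x)) ∧ HasSum (fun k => ‖f k‖ * ‖y k‖) c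

theorem nuclearNorm_eq (S : X →L[ℂ] X) : nuclearNorm S = sInf {c : ℝ | NucRep S c} := rfl

theorem NucRep.nonneg {S : X →L[ℂ] X} {c : ℝ} (h : NucRep S c) : 0 ≤ c := by
  obtain ⟨f, y, _, h2⟩ := h
  exact h2.nonneg (fun k => by positivity)

theorem isNuclear_iff (S : X →L[ℂ] X) : IsNuclear S ↔ ∃ c, NucRep S c := by
  constructor
  · rintro ⟨f, y, h1, h2⟩
    exact ⟨_, f, y, h2, h1.hasSum⟩
  · rintro ⟨c, f, y, h2, h1⟩
    exact ⟨f, y, h1.summable, h2⟩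

theorem NucRep.isNuclear {S : X →L[ℂ] X} {c : ℝ} (h : NucRep S c) : IsNuclear S :=
  (isNuclear_iff S).2 ⟨c, h⟩

theorem NucRep.of_denum {ι : Type} [Denumerable ι] {S : X →L[ℂ] X} {c : ℝ}
    (f : ι → (X →L[ℂ] ℂ)) (y : ι → X)
    (h1 : ∀ x : X, HasSum (fun k => f k x • y k) (S x))
    (h2 : HasSum (fun k => ‖f k‖ * ‖y k‖) c) : NucRep S c := by
  let e := (Denumerable.eqv ι).symm
  refine ⟨fun k => f (e k), fun k => y (e k), fun x => ?_, ?_⟩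
  · exact (e.hasSum_iff (f := fun k => f k x • y k)).2 (h1 x)
  · exact (e.hasSum_iff (f := fun k => ‖f k‖ * ‖y k‖)).2 h2

theorem NucRep.add {S R : X →L[ℂ] X} {c d : ℝ} (hS : NucRep S c) (hR : NucRep R d) :
    NucRep (S + R) (c + d) := by
  obtain ⟨f, y, h1, h2⟩ := hS
  obtain ⟨g, z, h3, h4⟩ := hR
  refine NucRep.of_denum (ι := ℕ ⊕ ℕ) (Sum.elim f g) (Sum.elim y z) (fun x => ?_) ?_
  · exact HasSum.sum (h1 x) (h3 x)
  · exact HasSum.sum h2 h4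

theorem NucRep.smul {S : X →L[ℂ] X} {c : ℝ} (a : ℂ) (hS : NucRep S c) :
    NucRep (a • S) (‖a‖ * c) := by
  obtain ⟨f, y, h1, h2⟩ := hS
  refine ⟨fun k => a • f k, y, fun x => ?_, ?_⟩
  · simpa [smul_smul] using (h1 x).const_smul a
  · simpa [norm_smul, mul_assoc] using h2.mul_left ‖a‖

theorem NucRep.zero : NucRep (0 : X →L[ℂ] X) 0 := by
  refine ⟨fun _ => 0, fun _ => 0, fun x => ?_, ?_⟩ <;> simp [hasSum_zero]

theorem NucRep.comp {S : X →L[ℂ] X} {c : ℝ} (hS : NucRep S c) (P Q : X →L[ℂ] X) :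
    ∃ c' ≤ ‖P‖ * ‖Q‖ * c, NucRep (P.comp (S.comp Q)) c' := by
  obtain ⟨f, y, h1, h2⟩ := hS
  have hle : ∀ k, ‖(f k).comp Q‖ * ‖P (y k)‖ ≤ (‖P‖ * ‖Q‖) * (‖f k‖ * ‖y k‖) := fun k =>
    calc ‖(f k).comp Q‖ * ‖P (y k)‖ ≤ (‖f k‖ * ‖Q‖) * (‖P‖ * ‖y k‖) := by
          gcongr
          · exact ContinuousLinearMap.opNorm_comp_le _ _
          · exact P.le_opNorm _
      _ = _ := by ring
  have hs : Summable (fun k => ‖(f k).comp Q‖ * ‖P (y k)‖) :=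
    Summable.of_nonneg_of_le (fun k => by positivity) hle (h2.summable.mul_left _)
  refine ⟨_, ?_, fun k => (f k).comp Q, fun k => P (y k), fun x => ?_, hs.hasSum⟩
  · exact hasSum_le hle hs.hasSum (h2.mul_left _)
  · simpa using (h1 (Q x)).mapL P

theorem NucRep.opNorm_le {S : X →L[ℂ] X} {c : ℝ} (hS : NucRep S c) : ‖S‖ ≤ c := by
  have h0 := hS.nonneg
  obtain ⟨f, y, h1, h2⟩ := hS
  refine S.opNorm_le_bound h0 fun x => ?_
  have h3 : HasSum (fun k => ‖f k‖ * ‖y k‖ * ‖x‖) (c * ‖x‖) := h2.mul_right _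
  have hle : ∀ k, ‖f k x • y k‖ ≤ ‖f k‖ * ‖y k‖ * ‖x‖ := fun k => by
    rw [norm_smul]
    calc ‖f k x‖ * ‖y k‖ ≤ (‖f k‖ * ‖x‖) * ‖y k‖ := by gcongr; exact (f k).le_opNorm x
      _ = _ := by ring
  rw [← (h1 x).tsum_eq]
  exact tsum_of_norm_bounded h3 hle

theorem NucRep.tsum {S : ℕ → X →L[ℂ] X} {c : ℕ → ℝ} {R : X →L[ℂ] X} (hS : ∀ n, NucRep (S n) (c n))
    (hc : Summable c) (hR : ∀ x, HasSum (fun n => S n x) (R x)) : NucRep R (∑' n, c n) := by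
  choose f y h1 h2 using hS
  have hs : Summable (fun p : ℕ × ℕ => ‖f p.1 p.2‖ * ‖y p.1 p.2‖) := by
    rw [summable_prod_of_nonneg (fun p => by positivity)]
    refine ⟨fun n => (h2 n).summable, ?_⟩
    simpa [fun n => (h2 n).tsum_eq] using hc
  refine NucRep.of_denum (ι := ℕ × ℕ) (fun p => f p.1 p.2) (fun p => y p.1 p.2) (fun x => ?_) ?_
  · have hsx : Summable (fun p : ℕ × ℕ => f p.1 p.2 x • y p.1 p.2) := by
      refine Summable.of_norm_bounded (hs.mul_right ‖x‖) fun p => ?_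
      rw [norm_smul]
      calc ‖f p.1 p.2 x‖ * ‖y p.1 p.2‖ ≤ (‖f p.1 p.2‖ * ‖x‖) * ‖y p.1 p.2‖ := by
            gcongr; exact (f p.1 p.2).le_opNorm x
        _ = _ := by ring
    have h3 := hsx.hasSum.prod_fiberwise (fun n => h1 n x)
    rw [(hR x).unique h3]
    exact hsx.hasSum
  · have h3 := hs.hasSum.prod_fiberwise (fun n => h2 n)
    rw [h3.tsum_eq]
    exact hs.hasSum

theorem nucRep_bddBelow (S : X →L[ℂ] X) : BddBelow {c : ℝ | NucRep S c} :=
  ⟨0, fun _ h => NucRep.nonneg h⟩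

theorem NucRep.norm_le {S : X →L[ℂ] X} {c : ℝ} (hS : NucRep S c) : nuclearNorm S ≤ c :=
  csInf_le (nucRep_bddBelow S) hS

theorem IsNuclear.exists_lt {S : X →L[ℂ] X} (hS : IsNuclear S) {ε : ℝ} (hε : 0 < ε) :
    ∃ c, NucRep S c ∧ c < nuclearNorm S + ε := by
  have hne : {c : ℝ | NucRep S c}.Nonempty := (isNuclear_iff S).1 hS
  obtain ⟨c, hc, h⟩ := exists_lt_of_csInf_lt hne (show sInf {c : ℝ | NucRep S c} < nuclearNorm S + ε by
    rw [← nuclearNorm_eq]; linarith)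
  exact ⟨c, hc, h⟩

theorem nuclearNorm_nonneg (S : X →L[ℂ] X) : 0 ≤ nuclearNorm S :=
  Real.sInf_nonneg (fun _ h => NucRep.nonneg h)

def nucSub (X : Type*) [NormedAddCommGroup X] [NormedSpace ℂ X] [CompleteSpace X] :
    Submodule ℂ (X →L[ℂ] X) where
  carrier := {S | IsNuclear S}
  add_mem' {S R} hS hR := by
    obtain ⟨c, hc⟩ := (isNuclear_iff S).1 hS
    obtain ⟨d, hd⟩ := (isNuclear_iff R).1 hR
    exact (hc.add hd).isNuclear
  zero_mem' := NucRep.zero.isNuclear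
  smul_mem' a S hS := by
    obtain ⟨c, hc⟩ := (isNuclear_iff S).1 hS
    exact (hc.smul a).isNuclear

def Nuc (X : Type*) [NormedAddCommGroup X] [NormedSpace ℂ X] [CompleteSpace X] : Type _ :=
  nucSub X

instance : AddCommGroup (Nuc X) := inferInstanceAs (AddCommGroup (nucSub X))
instance : Module ℂ (Nuc X) := inferInstanceAs (Module ℂ (nucSub X))

def Nuc.val : Nuc X →ₗ[ℂ] (X →L[ℂ] X) := (nucSub X).subtype

theorem Nuc.isNuclear (S : Nuc X) : IsNuclear (Nuc.val S) := S.2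

theorem Nuc.val_inj {S R : Nuc X} (h : Nuc.val S = Nuc.val R) : S = R := Subtype.ext h

def Nuc.mk (S : X →L[ℂ] X) (h : IsNuclear S) : Nuc X := ⟨S, h⟩

@[simp] theorem Nuc.val_mk (S : X →L[ℂ] X) (h : IsNuclear S) : Nuc.val (Nuc.mk S h) = S := rfl

instance : Norm (Nuc X) := ⟨fun S => nuclearNorm (Nuc.val S)⟩

theorem Nuc.norm_def (S : Nuc X) : ‖S‖ = nuclearNorm (Nuc.val S) := rfl

theorem Nuc.opNorm_le (S : Nuc X) : ‖Nuc.val S‖ ≤ ‖S‖ :=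
  le_csInf ((isNuclear_iff _).1 S.isNuclear) (fun _ h => NucRep.opNorm_le h)

theorem Nuc.norm_smul_le' (a : ℂ) (S : Nuc X) : ‖a • S‖ ≤ ‖a‖ * ‖S‖ := by
  refine le_of_forall_pos_le_add fun ε hε => ?_
  obtain ⟨c, hc, h⟩ := S.isNuclear.exists_lt (ε := ε / (‖a‖ + 1)) (by positivity)
  have h1 : ‖a • S‖ ≤ ‖a‖ * c := by
    rw [Nuc.norm_def, map_smul]; exact (hc.smul a).norm_le
  have h2 : ‖a‖ * (ε / (‖a‖ + 1)) ≤ ε := by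
    rw [mul_div_assoc', div_le_iff₀ (by positivity)]
    nlinarith [norm_nonneg a]
  calc ‖a • S‖ ≤ ‖a‖ * c := h1
    _ ≤ ‖a‖ * (nuclearNorm (Nuc.val S) + ε / (‖a‖ + 1)) := by gcongr
    _ ≤ ‖a‖ * ‖S‖ + ε := by rw [mul_add, Nuc.norm_def]; linarith

theorem nuc_core : NormedSpace.Core ℂ (Nuc X) where
  norm_nonneg S := nuclearNorm_nonneg _
  norm_smul a S := by
    refine le_antisymm (Nuc.norm_smul_le' a S) ?_
    rcases eq_or_ne a 0 with rfl | ha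
    · rw [norm_zero, zero_mul]; exact nuclearNorm_nonneg _
    · have h := Nuc.norm_smul_le' a⁻¹ (a • S)
      rw [smul_smul, inv_mul_cancel₀ ha, one_smul, norm_inv] at h
      calc ‖a‖ * ‖S‖ ≤ ‖a‖ * (‖a‖⁻¹ * ‖a • S‖) := by gcongr
        _ = ‖a • S‖ := by rw [← mul_assoc, mul_inv_cancel₀ (norm_ne_zero_iff.2 ha), one_mul]
  norm_triangle S R := by
    refine le_of_forall_pos_le_add fun ε hε => ?_
    obtain ⟨c, hc, h⟩ := S.isNuclear.exists_lt (ε := ε / 2) (by positivity)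
    obtain ⟨d, hd, h'⟩ := R.isNuclear.exists_lt (ε := ε / 2) (by positivity)
    have := (hc.add hd).norm_le
    rw [Nuc.norm_def, map_add, Nuc.norm_def, Nuc.norm_def]
    linarith
  norm_eq_zero_iff S := by
    constructor
    · intro h
      have := Nuc.opNorm_le S
      rw [h] at this
      exact Nuc.val_inj (by simpa using this)
    · rintro rfl
      refine le_antisymm ?_ (nuclearNorm_nonneg _)
      rw [Nuc.norm_def, map_zero]
      exact NucRep.zero.norm_le

instance : NormedAddCommGroup (Nuc X) := NormedAddCommGroup.ofCore nuc_core
instance : NormedSpace ℂ (Nuc X) := NormedSpace.ofCore nuc_core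

def Nuc.incl : Nuc X →L[ℂ] (X →L[ℂ] X) :=
  LinearMap.mkContinuous Nuc.val 1 (fun S => by rw [one_mul]; exact Nuc.opNorm_le S)

@[simp] theorem Nuc.incl_apply (S : Nuc X) : Nuc.incl S = Nuc.val S := rfl

instance : CompleteSpace (Nuc X) := by
  refine NormedAddCommGroup.completeSpace_of_summable_imp_tendsto fun u hu => ?_
  have hε : ∀ n : ℕ, (0 : ℝ) < (1 / 2) ^ n := fun n => by positivity
  choose c hc hlt using fun n => (u n).isNuclear.exists_lt (hε n)
  have hcs : Summable c := by
    refine Summable.of_nonneg_of_le (fun n => (hc n).nonneg) (fun n => (hlt n).le)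
      (hu.add summable_geometric_two)
  have hop : Summable (fun n => Nuc.val (u n)) :=
    Summable.of_norm_bounded hu (fun n => Nuc.opNorm_le (u n))
  have hx : ∀ x, HasSum (fun n => Nuc.val (u n) x) ((∑' n, Nuc.val (u n)) x) := fun x =>
    hop.hasSum.mapL (ContinuousLinearMap.apply ℂ X x)
  have hnuc := (NucRep.tsum hc hcs hx).isNuclear
  refine ⟨Nuc.mk _ hnuc, ?_⟩
  rw [tendsto_iff_norm_sub_tendsto_zero]
  refine squeeze_zero (fun _ => norm_nonneg _) (fun n => ?_) (tendsto_sum_nat_add c)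
  rw [norm_sub_rev]
  refine NucRep.norm_le (NucRep.tsum (S := fun k => Nuc.val (u (k + n))) (fun k => hc (k + n))
    ((summable_nat_add_iff n).2 hcs) (fun x => ?_))
  have := (hasSum_nat_add_iff' n).2 (hx x)
  convert this using 1
  simp

def Nuc.sandwich (P : X →L[ℂ] X) (S : Nuc X) (Q : X →L[ℂ] X) : Nuc X :=
  Nuc.mk (P.comp ((Nuc.val S).comp Q)) (by
    obtain ⟨c, hc⟩ := (isNuclear_iff _).1 S.isNuclear
    obtain ⟨c', -, h⟩ := hc.comp P Q
    exact h.isNuclear)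

@[simp] theorem Nuc.val_sandwich (P : X →L[ℂ] X) (S : Nuc X) (Q : X →L[ℂ] X) :
    Nuc.val (Nuc.sandwich P S Q) = P.comp ((Nuc.val S).comp Q) := rfl

theorem Nuc.norm_sandwich_le (P : X →L[ℂ] X) (S : Nuc X) (Q : X →L[ℂ] X) :
    ‖Nuc.sandwich P S Q‖ ≤ ‖P‖ * ‖Q‖ * ‖S‖ := by
  refine le_of_forall_pos_le_add fun ε hε => ?_
  obtain ⟨c, hc, h⟩ := S.isNuclear.exists_lt (ε := ε / (‖P‖ * ‖Q‖ + 1)) (by positivity)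
  obtain ⟨c', hc', hr⟩ := hc.comp P Q
  have h1 : ‖Nuc.sandwich P S Q‖ ≤ c' := hr.norm_le
  have h2 : ‖P‖ * ‖Q‖ * (ε / (‖P‖ * ‖Q‖ + 1)) ≤ ε := by
    rw [mul_div_assoc', div_le_iff₀ (by positivity)]
    nlinarith [mul_nonneg (norm_nonneg P) (norm_nonneg Q)]
  have h3 : ‖P‖ * ‖Q‖ * c ≤ ‖P‖ * ‖Q‖ * (nuclearNorm (Nuc.val S) + ε / (‖P‖ * ‖Q‖ + 1)) := by
    gcongr
  rw [mul_add] at h3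
  rw [Nuc.norm_def S]
  linarith

/-- `(P, Q) ↦ P S Q` as a continuous bilinear map. -/
def Nuc.sandwichL (S : Nuc X) : (X →L[ℂ] X) →L[ℂ] (X →L[ℂ] X) →L[ℂ] Nuc X :=
  LinearMap.mkContinuous₂
    (LinearMap.mk₂ ℂ (fun P Q => Nuc.sandwich P S Q)
      (fun P P' Q => Nuc.val_inj (by ext; simp))
      (fun a P Q => Nuc.val_inj (by ext; simp))
      (fun P Q Q' => Nuc.val_inj (by ext; simp))
      (fun a P Q => Nuc.val_inj (by ext; simp)))
    ‖S‖ (fun P Q => by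
      have := Nuc.norm_sandwich_le P S Q
      simp only [LinearMap.mk₂_apply]
      linarith)

@[simp] theorem Nuc.sandwichL_apply (S : Nuc X) (P Q : X →L[ℂ] X) :
    Nuc.sandwichL S P Q = Nuc.sandwich P S Q := rfl

/-! ### Duhamel formula -/

theorem HoloGen.hasDerivAt_real (A : HoloGen X) {s : ℝ} (hs : 0 < s) :
    HasDerivAt (fun r : ℝ => A.T (r : ℂ)) (deriv A.T (s : ℂ)) s := by
  have hopen : IsOpen {z : ℂ | 0 < z.re} := isOpen_lt continuous_const Complex.continuous_re
  have h1 : HasDerivAt A.T (deriv A.T (s : ℂ)) (s : ℂ) :=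
    ((A.holo (s : ℂ) (by simpa using hs)).differentiableAt
      (hopen.mem_nhds (by simpa using hs))).hasDerivAt
  have h2 := h1.scomp s (Complex.ofRealCLM.hasDerivAt (x := s))
  simpa [Function.comp_def] using h2

theorem HoloGen.hasDerivAt_apply (A : HoloGen X) {s : ℝ} (hs : 0 < s) (x : X) :
    HasDerivAt (fun r : ℝ => A.T (r : ℂ) x) (deriv A.T (s : ℂ) x) s := by
  exact ((ContinuousLinearMap.apply ℂ X x).restrictScalars ℝ).hasFDerivAt.comp_hasDerivAt s
    (A.hasDerivAt_real hs)

theorem HoloGen.tendsto_slope (A : HoloGen X) {s : ℝ} (hs : 0 < s) (x : X) :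
    Filter.Tendsto (fun t : ℝ => (t : ℂ)⁻¹ • (A.T ((s + t : ℝ) : ℂ) x - A.T (s : ℂ) x))
      (nhdsWithin 0 (Set.Ioi 0)) (nhds (deriv A.T (s : ℂ) x)) := by
  have h := (hasDerivAt_iff_tendsto_slope_zero.1 (A.hasDerivAt_apply hs x)).mono_left
    (nhdsWithin_mono 0 (fun y hy => ne_of_gt hy : Set.Ioi (0 : ℝ) ⊆ {0}ᶜ))
  refine h.congr fun t => ?_
  rw [← Complex.ofReal_inv, Complex.coe_smul]

theorem HoloGen.mem_dom_of_pos (A : HoloGen X) {s : ℝ} (hs : 0 < s) (x : X) :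
    A.T (s : ℂ) x ∈ A.dom ∧ A.gen (A.T (s : ℂ) x) = deriv A.T (s : ℂ) x := by
  have h : Filter.Tendsto (fun t : ℝ => (t : ℂ)⁻¹ • (A.T (t : ℂ) (A.T (s : ℂ) x) - A.T (s : ℂ) x))
      (nhdsWithin 0 (Set.Ioi 0)) (nhds (deriv A.T (s : ℂ) x)) := by
    refine (A.tendsto_slope hs x).congr' ?_
    filter_upwards [self_mem_nhdsWithin] with t ht
    rw [add_comm, A.T_add_real (le_of_lt ht) hs.le]
    rfl
  have hm : A.T (s : ℂ) x ∈ A.dom := (A.mem_dom_iff _).2 ⟨_, h⟩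
  exact ⟨hm, tendsto_nhds_unique (A.gen_spec _ hm) h⟩

theorem HoloGen.deriv_of_mem_dom (A : HoloGen X) {s : ℝ} (hs : 0 < s) {y : X} (hy : y ∈ A.dom) :
    deriv A.T (s : ℂ) y = A.T (s : ℂ) (A.gen y) := by
  have h := ((A.T (s : ℂ)).continuous.tendsto _).comp (A.gen_spec y hy)
  refine tendsto_nhds_unique (A.tendsto_slope hs y) (h.congr' ?_)
  filter_upwards [self_mem_nhdsWithin] with t ht
  rw [A.T_add_real hs.le (le_of_lt ht)]
  simp

theorem HoloGen.bound (A : HoloGen X) {M : ℝ} (hM : ∀ z : ℂ, 0 < z.re → ‖A.T z‖ ≤ M) {t : ℝ}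
    (ht : 0 ≤ t) : ‖A.T (t : ℂ)‖ ≤ max M 1 := by
  rcases ht.eq_or_lt with rfl | h
  · simp only [Complex.ofReal_zero, A.T_zero]
    exact le_trans ContinuousLinearMap.norm_id_le (le_max_right _ _)
  · exact le_trans (hM _ (by simpa using h)) (le_max_left _ _)

theorem HoloGen.continuousOn_joint (A : HoloGen X) {M : ℝ}
    (hM : ∀ z : ℂ, 0 < z.re → ‖A.T z‖ ≤ M) {S : Set ℝ} {t : ℝ → ℝ} {x : ℝ → X}
    (ht : ContinuousOn t S) (ht0 : ∀ s ∈ S, 0 ≤ t s) (hx : ContinuousOn x S) :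
    ContinuousOn (fun s => A.T ((t s : ℝ) : ℂ) (x s)) S := by
  intro s₀ hs₀
  have h1 : ContinuousWithinAt (fun s => A.T ((t s : ℝ) : ℂ) (x s₀)) S s₀ :=
    ((A.strong_cont (x s₀)).comp ht (fun s hs => ht0 s hs)) s₀ hs₀
  have h2 : Filter.Tendsto (fun s => A.T ((t s : ℝ) : ℂ) (x s - x s₀)) (nhdsWithin s₀ S)
      (nhds 0) := by
    have h3 : Filter.Tendsto (fun s => max M 1 * ‖x s - x s₀‖) (nhdsWithin s₀ S) (nhds 0) := by
      have := (tendsto_iff_norm_sub_tendsto_zero.1 (hx s₀ hs₀)).const_mul (max M 1)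
      simpa using this
    refine squeeze_zero_norm' ?_ h3
    filter_upwards [self_mem_nhdsWithin] with s hs
    exact (A.T _).le_of_opNorm_le (A.bound hM (ht0 s hs)) _
  have h4 := h2.add h1
  simpa [ContinuousWithinAt] using h4

theorem duhamel (A B : HoloGen X) (M : ℝ)
    (hMA : ∀ z : ℂ, 0 < z.re → ‖A.T z‖ ≤ M)
    (hMB : ∀ z : ℂ, 0 < z.re → ‖B.T z‖ ≤ M)
    (hdom : A.dom = B.dom) (Δ : X →L[ℂ] X) (hΔ : ∀ x ∈ A.dom, Δ x = A.gen x - B.gen x)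
    {u : ℝ} (hu : 0 < u) (x : X) :
    ∫ s in (0 : ℝ)..u, A.T ((u - s : ℝ) : ℂ) (Δ (B.T (s : ℂ) x))
      = A.T (u : ℂ) x - B.T (u : ℂ) x := by
  have hB : ContinuousOn (fun s : ℝ => B.T (s : ℂ) x) (Set.Icc 0 u) :=
    (B.strong_cont x).mono (fun s hs => hs.1)
  have hc : ContinuousOn (fun s : ℝ => u - s) (Set.Icc 0 u) := by fun_prop
  have hc0 : ∀ s ∈ Set.Icc 0 u, 0 ≤ u - s := fun s hs => by linarith [hs.2]
  have hf := A.continuousOn_joint hMA hc hc0 hB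
  have hf' := A.continuousOn_joint hMA hc hc0 (Δ.continuous.comp_continuousOn hB)
  have key := intervalIntegral.integral_eq_sub_of_hasDerivAt_of_le hu.le hf
    (f' := fun s => -(A.T ((u - s : ℝ) : ℂ) (Δ (B.T (s : ℂ) x)))) ?_ ?_
  · rw [intervalIntegral.integral_neg] at key
    have k2 := neg_eq_iff_eq_neg.1 key
    rw [k2]
    simp [A.T_zero, B.T_zero]
  · intro s hs
    have hus : 0 < u - s := by linarith [hs.2]
    have d1 : HasDerivAt (fun s : ℝ => A.T ((u - s : ℝ) : ℂ)) (-(deriv A.T ((u - s : ℝ) : ℂ))) s := by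
      have := (A.hasDerivAt_real hus).scomp s ((hasDerivAt_id s).const_sub u)
      simpa [Function.comp_def] using this
    have d1' : HasDerivAt (fun s : ℝ => (A.T ((u - s : ℝ) : ℂ)).restrictScalars ℝ)
        ((-(deriv A.T ((u - s : ℝ) : ℂ))).restrictScalars ℝ) s :=
      (ContinuousLinearMap.restrictScalarsL ℂ X X ℝ ℝ).hasFDerivAt.comp_hasDerivAt s d1
    have d2 := d1'.clm_apply (B.hasDerivAt_apply hs.1 x)
    simp only [ContinuousLinearMap.coe_restrictScalars'] at d2
    convert d2 using 1
    obtain ⟨m1, m2⟩ := B.mem_dom_of_pos hs.1 x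
    rw [ContinuousLinearMap.neg_apply, A.deriv_of_mem_dom hus (hdom ▸ m1), ← m2,
      hΔ _ (hdom ▸ m1), map_sub]
    abel
  · exact (ContinuousOn.intervalIntegrable_of_Icc hu.le hf').neg

theorem HoloGen.continuousOn_pos (A : HoloGen X) :
    ContinuousOn (fun t : ℝ => A.T (t : ℂ)) (Set.Ioi 0) :=
  fun _ ht => (A.hasDerivAt_real ht).continuousAt.continuousWithinAt

/-- The nuclear-operator-valued family `T_A(u) - T_B(u)`. -/
def diffNuc (A B : HoloGen X) (N : Nuc X) (u : ℝ) : Nuc X :=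
  u • ∫ r in Set.Ioo (0 : ℝ) 1,
    Nuc.sandwichL N (A.T ((u * (1 - r) : ℝ) : ℂ)) (B.T ((u * r : ℝ) : ℂ))

section

theorem sandwich_contOn_r (A B : HoloGen X) (N : Nuc X) {u : ℝ} (hu : 0 < u) :
    ContinuousOn (fun r : ℝ => Nuc.sandwichL N (A.T ((u * (1 - r) : ℝ) : ℂ))
      (B.T ((u * r : ℝ) : ℂ))) (Set.Ioo 0 1) := by
  refine ContinuousOn.clm_apply ?_ ?_
  · refine (Nuc.sandwichL N).continuous.comp_continuousOn
      (A.continuousOn_pos.comp (f := fun r : ℝ => u * (1 - r)) (by fun_prop) ?_)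
    intro r hr
    exact mul_pos hu (by linarith [hr.2])
  · refine (B.continuousOn_pos.comp (f := fun r : ℝ => u * r) (by fun_prop) ?_)
    intro r hr
    exact mul_pos hu hr.1

theorem sandwich_contOn_u (A B : HoloGen X) (N : Nuc X) {r : ℝ} (hr : r ∈ Set.Ioo (0 : ℝ) 1) :
    ContinuousOn (fun u : ℝ => Nuc.sandwichL N (A.T ((u * (1 - r) : ℝ) : ℂ))
      (B.T ((u * r : ℝ) : ℂ))) (Set.Ioi 0) := by
  refine ContinuousOn.clm_apply ?_ ?_
  · refine (Nuc.sandwichL N).continuous.comp_continuousOn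
      (A.continuousOn_pos.comp (f := fun u : ℝ => u * (1 - r)) (by fun_prop) ?_)
    intro u hu
    exact mul_pos (Set.mem_Ioi.1 hu) (by linarith [hr.2])
  · refine (B.continuousOn_pos.comp (f := fun u : ℝ => u * r) (by fun_prop) ?_)
    intro u hu
    exact mul_pos (Set.mem_Ioi.1 hu) hr.1

theorem sandwich_bound (A B : HoloGen X) (M : ℝ)
    (hMA : ∀ z : ℂ, 0 < z.re → ‖A.T z‖ ≤ M)
    (hMB : ∀ z : ℂ, 0 < z.re → ‖B.T z‖ ≤ M) (N : Nuc X) {u r : ℝ} (hu : 0 < u) (hr : r ∈ Set.Ioo (0 : ℝ) 1) :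
    ‖Nuc.sandwichL N (A.T ((u * (1 - r) : ℝ) : ℂ)) (B.T ((u * r : ℝ) : ℂ))‖ ≤ M * M * ‖N‖ := by
  have h1 := hMA ((u * (1 - r) : ℝ) : ℂ)
    (by rw [Complex.ofReal_re]; exact mul_pos hu (by linarith [hr.2]))
  have h2 := hMB ((u * r : ℝ) : ℂ) (by rw [Complex.ofReal_re]; exact mul_pos hu hr.1)
  have h0 : 0 ≤ M := le_trans (norm_nonneg _) h1
  refine (Nuc.norm_sandwich_le _ _ _).trans ?_
  gcongr

theorem sandwich_integrable (A B : HoloGen X) (M : ℝ)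
    (hMA : ∀ z : ℂ, 0 < z.re → ‖A.T z‖ ≤ M)
    (hMB : ∀ z : ℂ, 0 < z.re → ‖B.T z‖ ≤ M) (N : Nuc X) {u : ℝ} (hu : 0 < u) :
    Integrable (fun r : ℝ => Nuc.sandwichL N (A.T ((u * (1 - r) : ℝ) : ℂ))
      (B.T ((u * r : ℝ) : ℂ))) (volume.restrict (Set.Ioo 0 1)) := by
  refine Integrable.of_bound
    ((sandwich_contOn_r A B N hu).aestronglyMeasurable measurableSet_Ioo) (M * M * ‖N‖) ?_
  filter_upwards [ae_restrict_mem measurableSet_Ioo] with r hr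
  exact sandwich_bound A B M hMA hMB N hu hr

theorem diffNuc_contOn (A B : HoloGen X) (M : ℝ)
    (hMA : ∀ z : ℂ, 0 < z.re → ‖A.T z‖ ≤ M)
    (hMB : ∀ z : ℂ, 0 < z.re → ‖B.T z‖ ≤ M) (N : Nuc X) : ContinuousOn (diffNuc A B N) (Set.Ioi 0) := by
  refine continuousOn_id.smul (MeasureTheory.continuousOn_of_dominated
    (bound := fun _ => M * M * ‖N‖) ?_ ?_ ?_ ?_)
  · intro u hu
    exact (sandwich_contOn_r A B N hu).aestronglyMeasurable measurableSet_Ioo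
  · intro u hu
    filter_upwards [ae_restrict_mem measurableSet_Ioo] with r hr
    exact sandwich_bound A B M hMA hMB N hu hr
  · exact integrable_const _
  · filter_upwards [ae_restrict_mem measurableSet_Ioo] with r hr
    exact sandwich_contOn_u A B N hr

theorem diffNuc_bound (A B : HoloGen X) (M : ℝ)
    (hMA : ∀ z : ℂ, 0 < z.re → ‖A.T z‖ ≤ M)
    (hMB : ∀ z : ℂ, 0 < z.re → ‖B.T z‖ ≤ M) (N : Nuc X) {u : ℝ} (hu : 0 < u) : ‖diffNuc A B N u‖ ≤ M * M * ‖N‖ * u := by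
  rw [diffNuc, norm_smul, Real.norm_of_nonneg hu.le, mul_comm]
  gcongr
  have := norm_setIntegral_le_of_norm_le_const (μ := volume) (s := Set.Ioo (0 : ℝ) 1)
    (by simp) (fun r hr => sandwich_bound A B M hMA hMB N hu hr)
  simpa using this

theorem diffNuc_val (A B : HoloGen X) (M : ℝ)
    (hMA : ∀ z : ℂ, 0 < z.re → ‖A.T z‖ ≤ M)
    (hMB : ∀ z : ℂ, 0 < z.re → ‖B.T z‖ ≤ M) (N : Nuc X) (hdom : A.dom = B.dom)
    (hΔ : ∀ x ∈ A.dom, Nuc.val N x = A.gen x - B.gen x) {u : ℝ} (hu : 0 < u) :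
    Nuc.val (diffNuc A B N u) = A.T (u : ℂ) - B.T (u : ℂ) := by
  ext x
  let L : Nuc X →L[ℂ] X := (ContinuousLinearMap.apply ℂ X x).comp Nuc.incl
  have hL : ∀ S, L S = Nuc.val S x := fun S => rfl
  rw [← hL, diffNuc]
  have h1 := L.integral_comp_comm (sandwich_integrable A B M hMA hMB N hu)
  have h2 : L (u • ∫ r in Set.Ioo (0 : ℝ) 1,
      Nuc.sandwichL N (A.T ((u * (1 - r) : ℝ) : ℂ)) (B.T ((u * r : ℝ) : ℂ)))
      = u • L (∫ r in Set.Ioo (0 : ℝ) 1,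
      Nuc.sandwichL N (A.T ((u * (1 - r) : ℝ) : ℂ)) (B.T ((u * r : ℝ) : ℂ))) := by
    rw [← Complex.coe_smul, map_smul, Complex.coe_smul]
  rw [h2, ← h1, sub_apply,
    ← duhamel A B M hMA hMB hdom (Nuc.val N) hΔ hu x, ← integral_Ioc_eq_integral_Ioo,
    ← intervalIntegral.integral_of_le zero_le_one]
  have h3 := intervalIntegral.smul_integral_comp_mul_left (a := 0) (b := 1)
    (fun s : ℝ => A.T ((u - s : ℝ) : ℂ) (Nuc.val N (B.T (s : ℂ) x))) u
  rw [mul_zero, mul_one] at h3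
  rw [← h3]
  simp only [hL, Nuc.sandwichL_apply, Nuc.val_sandwich, ContinuousLinearMap.comp_apply, mul_sub,
    mul_one]
end

/-! ### The test space and the embedding -/

theorem pow_mul_exp_le (m : ℕ) {w t : ℝ} (hw : 0 < w) (ht : 0 ≤ t) :
    t ^ m * Real.exp (-(t * w)) ≤ (m.factorial : ℝ) * (w ^ m)⁻¹ := by
  have h := Real.pow_div_factorial_le_exp (t * w) (by positivity) m
  have hf : (0 : ℝ) < m.factorial := by exact_mod_cast m.factorial_pos
  rw [div_le_iff₀ hf] at h
  rw [Real.exp_neg, ← div_eq_mul_inv, ← div_eq_mul_inv,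
    div_le_div_iff₀ (Real.exp_pos _) (by positivity), ← mul_pow]
  linarith

theorem testSet_contDiffAt {φ : ℝ → ℂ} (h : φ ∈ TestSet) (n : ℕ) (t : ℝ) :
    ContDiffAt ℝ n φ t :=
  (h.1.of_le (by exact_mod_cast le_top)).contDiffAt

theorem testSet_cont {φ : ℝ → ℂ} (h : φ ∈ TestSet) (n : ℕ) : Continuous (iteratedDeriv n φ) :=
  h.1.continuous_iteratedDeriv n (by exact_mod_cast le_top)

def testSub : Submodule ℂ (ℝ → ℂ) where
  carrier := TestSet
  add_mem' {φ χ} hφ hχ := by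
    refine ⟨hφ.1.add hχ.1, fun j m => ?_⟩
    obtain ⟨C, hC⟩ := hφ.2 j m
    obtain ⟨C', hC'⟩ := hχ.2 j m
    refine ⟨C + C', fun t ht => ?_⟩
    rw [iteratedDeriv_add (testSet_contDiffAt hφ j t) (testSet_contDiffAt hχ j t)]
    have h1 := norm_add_le (iteratedDeriv j φ t) (iteratedDeriv j χ t)
    have h2 := mul_le_mul_of_nonneg_left h1 (pow_nonneg ht m)
    linarith [hC t ht, hC' t ht]
  zero_mem' := by
    refine ⟨contDiff_const, fun j m => ⟨0, fun t ht => ?_⟩⟩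
    have : iteratedDeriv j (0 : ℝ → ℂ) t = 0 := by
      simp
    simp [this]
  smul_mem' c φ hφ := by
    refine ⟨contDiff_const.smul hφ.1, fun j m => ?_⟩
    obtain ⟨C, hC⟩ := hφ.2 j m
    refine ⟨‖c‖ * C, fun t ht => ?_⟩
    rw [iteratedDeriv_const_smul (testSet_contDiffAt hφ j t), norm_smul]
    have := mul_le_mul_of_nonneg_left (hC t ht) (norm_nonneg c)
    linarith

open BoundedContinuousFunction in
/-- one component of the embedding -/
def embC (j m : ℕ) (φ : testSub) : BoundedContinuousFunction (Set.Ioi (0 : ℝ)) ℂ :=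
  BoundedContinuousFunction.ofNormedAddCommGroup
    (fun t => ((t : ℝ) : ℂ) ^ m * iteratedDeriv j φ.1 t)
    (by
      have := testSet_cont φ.2 j
      fun_prop)
    (φ.2.2 j m).choose
    (fun t => by
      have := (φ.2.2 j m).choose_spec t (le_of_lt t.2)
      simpa [abs_of_pos (show (0 : ℝ) < t from t.2)] using this)

theorem embC_apply (j m : ℕ) (φ : testSub) (t : Set.Ioi (0 : ℝ)) :
    embC j m φ t = ((t : ℝ) : ℂ) ^ m * iteratedDeriv j φ.1 t := rfl

abbrev EE (k : ℕ) := Fin (k + 1) × Fin (k + 1) → BoundedContinuousFunction (Set.Ioi (0 : ℝ)) ℂ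

def emb (k : ℕ) : testSub →ₗ[ℂ] EE k where
  toFun φ := fun p => embC p.1 p.2 φ
  map_add' φ χ := by
    ext p t
    simp only [Pi.add_apply, BoundedContinuousFunction.add_apply, embC_apply, Submodule.coe_add]
    rw [iteratedDeriv_add (testSet_contDiffAt φ.2 _ _) (testSet_contDiffAt χ.2 _ _), mul_add]
  map_smul' c φ := by
    ext p t
    simp only [Pi.smul_apply, BoundedContinuousFunction.smul_apply, embC_apply, Submodule.coe_smul,
      RingHom.id_apply]
    rw [iteratedDeriv_const_smul (testSet_contDiffAt φ.2 _ _), smul_eq_mul, smul_eq_mul]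
    ring

theorem emb_apply (k : ℕ) (φ : testSub) (p : Fin (k + 1) × Fin (k + 1)) (t : Set.Ioi (0 : ℝ)) :
    emb k φ p t = ((t : ℝ) : ℂ) ^ (p.2 : ℕ) * iteratedDeriv p.1 φ.1 t := rfl

theorem sNorm_nonneg (j m : ℕ) (φ : ℝ → ℂ) : 0 ≤ sNorm j m φ :=
  Real.sInf_nonneg (fun C hC => le_trans (by positivity) (hC 0 le_rfl))

theorem sNorm_le_embC (j m : ℕ) (φ : testSub) : sNorm j m φ.1 ≤ ‖embC j m φ‖ := by
  refine csInf_le ⟨0, fun C hC => le_trans (by positivity) (hC 0 le_rfl)⟩ ?_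
  have hc := testSet_cont φ.2 j
  have hcl : IsClosed {t : ℝ | t ^ m * ‖iteratedDeriv j φ.1 t‖ ≤ ‖embC j m φ‖} :=
    isClosed_le (by fun_prop) continuous_const
  have hsub : Set.Ioi (0 : ℝ) ⊆ {t : ℝ | t ^ m * ‖iteratedDeriv j φ.1 t‖ ≤ ‖embC j m φ‖} := by
    intro t ht
    have := (embC j m φ).norm_coe_le_norm ⟨t, ht⟩
    rw [embC_apply] at this
    simpa [abs_of_pos (show (0 : ℝ) < t from ht)] using this
  have h := hcl.closure_subset_iff.2 hsub
  rw [closure_Ioi] at h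
  exact fun t ht => h ht

theorem hahn_banach_factor {V E : Type*} [AddCommGroup V] [Module ℂ V] [NormedAddCommGroup E]
    [NormedSpace ℂ E] (ι : V →ₗ[ℂ] E) (ξ : V →ₗ[ℂ] ℂ) (C : ℝ) (h : ∀ v, ‖ξ v‖ ≤ C * ‖ι v‖) :
    ∃ g : E →L[ℂ] ℂ, ∀ v, g (ι v) = ξ v := by
  obtain ⟨s, hs⟩ := LinearMap.exists_rightInverse_of_surjective ι.rangeRestrict
    (LinearMap.range_rangeRestrict ι)
  have hs' : ∀ e : LinearMap.range ι, ι (s e) = e := fun e => by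
    have := LinearMap.congr_fun hs e
    exact congrArg Subtype.val this
  let f : LinearMap.range ι →L[ℂ] ℂ := LinearMap.mkContinuous (ξ.comp s) C (fun e => by
    have := h (s e)
    rw [hs'] at this
    exact this)
  obtain ⟨g, hg, -⟩ := exists_extension_norm_eq (LinearMap.range ι) f
  refine ⟨g, fun v => ?_⟩
  have h1 := hg ⟨ι v, v, rfl⟩
  change g (ι v) = ξ (s ⟨ι v, v, rfl⟩) at h1
  rw [h1, ← sub_eq_zero, ← map_sub, ← norm_le_zero_iff]
  refine (h _).trans ?_
  rw [map_sub, hs']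
  simp

theorem exists_extension (ξ : (ℝ → ℂ) → ℂ) (hξ : IsTemperedDistRplus ξ) :
    ∃ (k : ℕ) (g : EE k →L[ℂ] ℂ), ∀ φ : testSub, g (emb k φ) = ξ φ.1 := by
  obtain ⟨h1, h2, k, C, h3⟩ := hξ
  let ξ' : testSub →ₗ[ℂ] ℂ :=
    { toFun := fun φ => ξ φ.1
      map_add' := fun φ χ => h1 _ φ.2 _ χ.2
      map_smul' := fun c φ => h2 c _ φ.2 }
  refine ⟨k, hahn_banach_factor (emb k) ξ' (|C| * ((k + 1 : ℕ) * (k + 1 : ℕ))) (fun φ => ?_)⟩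
  have hb : ∑ j ∈ Finset.range (k + 1), ∑ m ∈ Finset.range (k + 1), sNorm j m φ.1
      ≤ ((k + 1 : ℕ) * (k + 1 : ℕ)) * ‖emb k φ‖ := by
    have : ∀ j ∈ Finset.range (k + 1), ∑ m ∈ Finset.range (k + 1), sNorm j m φ.1
        ≤ (k + 1 : ℕ) * ‖emb k φ‖ := by
      intro j hj
      have : ∀ m ∈ Finset.range (k + 1), sNorm j m φ.1 ≤ ‖emb k φ‖ := by
        intro m hm
        refine (sNorm_le_embC j m φ).trans ?_
        exact norm_le_pi_norm (emb k φ)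
          (⟨j, Finset.mem_range.1 hj⟩, ⟨m, Finset.mem_range.1 hm⟩)
      simpa using Finset.sum_le_card_nsmul _ _ _ this
    have := Finset.sum_le_card_nsmul _ _ _ this
    simpa [mul_assoc] using this
  calc ‖ξ' φ‖ ≤ C * ∑ j ∈ Finset.range (k + 1), ∑ m ∈ Finset.range (k + 1), sNorm j m φ.1 :=
        h3 _ φ.2
    _ ≤ |C| * ∑ j ∈ Finset.range (k + 1), ∑ m ∈ Finset.range (k + 1), sNorm j m φ.1 := by
        gcongr
        · exact Finset.sum_nonneg fun j _ => Finset.sum_nonneg fun m _ => sNorm_nonneg _ _ _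
        · exact le_abs_self C
    _ ≤ |C| * (((k + 1 : ℕ) * (k + 1 : ℕ)) * ‖emb k φ‖) := by gcongr
    _ = _ := by ring

/-! ### Exponentials as test functions -/

def expFun (u : ℝ) : ℝ → ℂ := fun t => Complex.exp (-((u : ℂ) * (t : ℂ)))

theorem iteratedDeriv_expFun (u : ℝ) (j : ℕ) :
    iteratedDeriv j (expFun u) = fun t => (-(u : ℂ)) ^ j * expFun u t := by
  induction j with
  | zero => simp
  | succ j ih =>
    rw [iteratedDeriv_succ, ih]
    funext t
    have h1 : HasDerivAt (fun t : ℝ => (t : ℂ)) 1 t := Complex.ofRealCLM.hasDerivAt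
    have h2 : HasDerivAt (fun t : ℝ => -((u : ℂ) * (t : ℂ))) (-((u : ℂ) * 1)) t :=
      (h1.const_mul (u : ℂ)).neg
    have h3 := (h2.cexp).const_mul ((-(u : ℂ)) ^ j)
    have h4 := h3.deriv
    simp only [expFun]
    rw [h4]
    ring

theorem expFun_eq (u t : ℝ) : expFun u t = ((Real.exp (-(t * u)) : ℝ) : ℂ) := by
  simp [expFun, mul_comm]

theorem expFun_mem {u : ℝ} (hu : 0 < u) : expFun u ∈ TestSet := by
  refine ⟨?_, fun j m => ⟨u ^ j * (m.factorial * (u ^ m)⁻¹), fun t ht => ?_⟩⟩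
  · unfold expFun
    have : ContDiff ℝ (⊤ : ℕ∞) (fun t : ℝ => (t : ℂ)) := Complex.ofRealCLM.contDiff
    fun_prop
  · rw [iteratedDeriv_expFun]
    simp only [expFun_eq, norm_mul, norm_pow, norm_neg, Complex.norm_real, Real.norm_eq_abs,
      abs_of_pos hu, Real.abs_exp]
    have := mul_le_mul_of_nonneg_left (pow_mul_exp_le m hu ht) (pow_nonneg hu.le j)
    linarith

open Classical in
def expT (u : ℝ) : testSub := if h : 0 < u then ⟨expFun u, expFun_mem h⟩ else 0

theorem expT_val {u : ℝ} (hu : 0 < u) : (expT u).1 = expFun u := by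
  simp [expT, hu]

/-- integral kernel -/
def kerR (j : ℕ) (t v : ℝ) : ℝ := (-v) ^ j * (Real.exp (-(t * v)) * v)

def HH (k : ℕ) (u : ℝ) : EE k := (u : ℂ) • emb k (expT u)

theorem HH_apply (k : ℕ) {u : ℝ} (hu : 0 < u) (p : Fin (k + 1) × Fin (k + 1))
    (t : Set.Ioi (0 : ℝ)) :
    HH k u p t = (((t : ℝ) ^ (p.2 : ℕ) * kerR p.1 t u : ℝ) : ℂ) := by
  simp only [HH, Pi.smul_apply, BoundedContinuousFunction.smul_apply, emb_apply, expT_val hu,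
    iteratedDeriv_expFun, expFun_eq, kerR, smul_eq_mul]
  push_cast
  ring

theorem abs_kerR (j : ℕ) (t : ℝ) {v : ℝ} (hv : 0 < v) :
    |kerR j t v| = v ^ (j + 1) * Real.exp (-(t * v)) := by
  rw [kerR, abs_mul, abs_pow, abs_neg, abs_of_pos hv, abs_of_pos (by positivity)]
  ring

theorem HH_bound (k : ℕ) {u : ℝ} (hu : 0 < u) :
    ‖HH k u‖ ≤ k.factorial * (u ^ (k + 1) + u * (u ^ k)⁻¹) := by
  refine (pi_norm_le_iff_of_nonneg (by positivity)).2 fun p => ?_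
  refine (BoundedContinuousFunction.norm_le (by positivity)).2 fun t => ?_
  rw [HH_apply k hu, Complex.norm_real, Real.norm_eq_abs, abs_mul, abs_kerR _ _ hu,
    abs_pow, abs_of_pos (show (0 : ℝ) < t from t.2)]
  obtain ⟨j, m⟩ := p
  have hj : (j : ℕ) ≤ k := Nat.lt_succ_iff.1 j.2
  have hm : (m : ℕ) ≤ k := Nat.lt_succ_iff.1 m.2
  simp only
  have h1 := pow_mul_exp_le m hu (le_of_lt t.2)
  have h2 : (((m : ℕ).factorial : ℕ) : ℝ) ≤ k.factorial := by
    exact_mod_cast Nat.factorial_le hm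
  have h3 : u ^ (j : ℕ) * (u ^ (m : ℕ))⁻¹ ≤ u ^ k + (u ^ k)⁻¹ := by
    rcases le_total 1 u with h | h
    · have a1 : u ^ (j : ℕ) ≤ u ^ k := pow_le_pow_right₀ h hj
      have a2 : (u ^ (m : ℕ))⁻¹ ≤ 1 := inv_le_one_of_one_le₀ (one_le_pow₀ h)
      have a3 : u ^ (j : ℕ) * (u ^ (m : ℕ))⁻¹ ≤ u ^ k * 1 := by gcongr
      have : 0 < (u ^ k)⁻¹ := by positivity
      linarith
    · have a1 : u ^ (j : ℕ) ≤ 1 := pow_le_one₀ hu.le h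
      have a2 : (u ^ (m : ℕ))⁻¹ ≤ (u ^ k)⁻¹ := by
        apply inv_anti₀ (by positivity)
        exact pow_le_pow_of_le_one hu.le h hm
      have a3 : u ^ (j : ℕ) * (u ^ (m : ℕ))⁻¹ ≤ 1 * (u ^ k)⁻¹ := by gcongr
      have : 0 < u ^ k := by positivity
      linarith
  calc (t : ℝ) ^ (m : ℕ) * (u ^ ((j : ℕ) + 1) * Real.exp (-((t : ℝ) * u)))
      = u ^ ((j : ℕ) + 1) * ((t : ℝ) ^ (m : ℕ) * Real.exp (-((t : ℝ) * u))) := by ring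
    _ ≤ u ^ ((j : ℕ) + 1) * (((m : ℕ).factorial : ℝ) * (u ^ (m : ℕ))⁻¹) := by gcongr
    _ ≤ u ^ ((j : ℕ) + 1) * ((k.factorial : ℝ) * (u ^ (m : ℕ))⁻¹) := by gcongr
    _ = k.factorial * u * (u ^ (j : ℕ) * (u ^ (m : ℕ))⁻¹) := by ring
    _ ≤ k.factorial * u * (u ^ k + (u ^ k)⁻¹) := by gcongr
    _ = _ := by ring

theorem kerR_hasDerivAt_v (j : ℕ) (t w : ℝ) :
    HasDerivAt (fun w => kerR j t w) ((-1) ^ j * (((j + 1 : ℕ) * w ^ j) * Real.exp (-(t * w))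
      + w ^ (j + 1) * (Real.exp (-(t * w)) * -t))) w := by
  have h1 : HasDerivAt (fun w : ℝ => -(t * w)) (-t) w := by
    simpa using ((hasDerivAt_id' w).const_mul t).fun_neg
  have h2 := ((hasDerivAt_pow (j + 1) w).mul h1.exp).const_mul ((-1 : ℝ) ^ j)
  have he : (fun w => kerR j t w) = fun w => (-1) ^ j * (w ^ (j + 1) * Real.exp (-(t * w))) := by
    funext w
    rw [kerR, neg_pow]
    ring
  rw [he]
  simpa using h2

theorem kerR_lip (j m : ℕ) {a : ℝ} (ha : 0 < a) : ∃ K : ℝ, 0 ≤ K ∧ ∀ t : ℝ, 0 < t →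
    ∀ w ∈ Set.Ioo (a / 2) (2 * a), |t ^ m * kerR j t w - t ^ m * kerR j t a| ≤ K * |w - a| := by
  refine ⟨(j + 1 : ℕ) * (2 * a) ^ j * (m.factorial * ((a / 2) ^ m)⁻¹) +
    (2 * a) ^ (j + 1) * ((m + 1).factorial * ((a / 2) ^ (m + 1))⁻¹), by positivity, ?_⟩
  intro t ht w hw
  have := Convex.norm_image_sub_le_of_norm_hasDerivWithin_le (s := Set.Ioo (a / 2) (2 * a))
    (f := fun w => t ^ m * kerR j t w) (x := a) (y := w)
    (C := (j + 1 : ℕ) * (2 * a) ^ j * (m.factorial * ((a / 2) ^ m)⁻¹) +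
    (2 * a) ^ (j + 1) * ((m + 1).factorial * ((a / 2) ^ (m + 1))⁻¹))
    (fun x _ => ((kerR_hasDerivAt_v j t x).const_mul (t ^ m)).hasDerivWithinAt) ?_
    (convex_Ioo _ _) ⟨by linarith, by linarith⟩ hw
  · simpa using this
  · intro x hx
    have hx0 : 0 < x := by linarith [hx.1]
    have hx2 : x ≤ 2 * a := hx.2.le
    have b1 : t ^ m * Real.exp (-(t * x)) ≤ m.factorial * ((a / 2) ^ m)⁻¹ := by
      refine (pow_mul_exp_le m hx0 ht.le).trans ?_
      gcongr
      exact hx.1.le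
    have b2 : t ^ (m + 1) * Real.exp (-(t * x)) ≤ (m + 1).factorial * ((a / 2) ^ (m + 1))⁻¹ := by
      refine (pow_mul_exp_le (m + 1) hx0 ht.le).trans ?_
      gcongr
      exact hx.1.le
    have e : t ^ m * ((-1) ^ j * (((j + 1 : ℕ) * x ^ j) * Real.exp (-(t * x))
      + x ^ (j + 1) * (Real.exp (-(t * x)) * -t))) = (-1) ^ j * (
        ((j + 1 : ℕ) * x ^ j) * (t ^ m * Real.exp (-(t * x))) -
        x ^ (j + 1) * (t ^ (m + 1) * Real.exp (-(t * x)))) := by ring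
    rw [e, norm_mul, norm_pow, norm_neg, norm_one, one_pow, one_mul]
    refine (norm_sub_le _ _).trans ?_
    rw [Real.norm_of_nonneg (by positivity), Real.norm_of_nonneg (by positivity)]
    gcongr

theorem HH_contOn (k : ℕ) : ContinuousOn (HH k) (Set.Ioi 0) := by
  refine continuousOn_pi.2 fun p => ?_
  intro a ha
  have ha : 0 < a := ha
  apply ContinuousAt.continuousWithinAt
  obtain ⟨K, hK0, hK⟩ := kerR_lip p.1 p.2 ha
  have h0 : Filter.Tendsto (fun w : ℝ => K * |w - a|) (nhds a) (nhds 0) := by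
    have : Continuous (fun w : ℝ => K * |w - a|) := by fun_prop
    simpa using this.tendsto a
  rw [ContinuousAt, tendsto_iff_norm_sub_tendsto_zero]
  refine squeeze_zero' (Filter.Eventually.of_forall fun _ => norm_nonneg _) ?_ h0
  filter_upwards [Ioo_mem_nhds (show a / 2 < a by linarith) (show a < 2 * a by linarith)] with w hw
  refine (BoundedContinuousFunction.norm_le (by positivity)).2 fun t => ?_
  rw [BoundedContinuousFunction.sub_apply, HH_apply k (by linarith [hw.1]), HH_apply k ha,
    ← Complex.ofReal_sub, Complex.norm_real, Real.norm_eq_abs]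
  exact hK t t.2 w hw

/-! ### Moments of the representing measure -/

theorem ae_pos {μ : Measure ℝ} (hsupp : μ {v : ℝ | v ≤ 0} = 0) : ∀ᵐ v ∂μ, 0 < v := by
  rw [ae_iff]
  simpa using hsupp

theorem restrict_pos {μ : Measure ℝ} (hsupp : μ {v : ℝ | v ≤ 0} = 0) :
    μ.restrict (Set.Ioi 0) = μ :=
  Measure.restrict_eq_self_of_ae_mem (ae_pos hsupp)

theorem kerR_cont (j : ℕ) (t : ℝ) : Continuous (kerR j t) := by
  unfold kerR
  fun_prop

theorem abs_kerR_le (j : ℕ) {t v : ℝ} (ht : 0 < t) (hv : 0 < v) :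
    |kerR j t v| ≤ (j.factorial * (t ^ j)⁻¹) * v := by
  rw [abs_kerR j t hv]
  have := mul_le_mul_of_nonneg_right (pow_mul_exp_le j ht hv.le) hv.le
  rw [mul_comm v t] at this
  calc v ^ (j + 1) * Real.exp (-(t * v)) = v ^ j * Real.exp (-(t * v)) * v := by ring
    _ ≤ _ := this

theorem kerR_integrable {μ : Measure ℝ} (hsupp : μ {v : ℝ | v ≤ 0} = 0)
    (hd : Integrable (fun v => v) μ) (j : ℕ) {t : ℝ} (ht : 0 < t) : Integrable (kerR j t) μ := by
  refine Integrable.mono' (hd.const_mul (j.factorial * (t ^ j)⁻¹))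
    (kerR_cont j t).aestronglyMeasurable ?_
  filter_upwards [ae_pos hsupp] with v hv
  exact abs_kerR_le j ht hv

theorem kerR_int_hasDerivAt {μ : Measure ℝ} (hsupp : μ {v : ℝ | v ≤ 0} = 0)
    (hd : Integrable (fun v => v) μ) (j : ℕ) {t : ℝ} (ht : 0 < t) :
    HasDerivAt (fun s => ∫ v, kerR j s v ∂μ) (∫ v, kerR (j + 1) t v ∂μ) t := by
  refine (hasDerivAt_integral_of_dominated_loc_of_deriv_le (F := fun s v => kerR j s v)
    (F' := fun s v => kerR (j + 1) s v) (s := Set.Ioi (t / 2))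
    (bound := fun v => ((j + 1).factorial * ((t / 2) ^ (j + 1))⁻¹) * v)
    (Ioi_mem_nhds (by linarith)) ?_ (kerR_integrable hsupp hd j ht)
    (kerR_cont _ _).aestronglyMeasurable ?_ (hd.const_mul _) ?_).2
  · exact Filter.Eventually.of_forall fun s => (kerR_cont _ _).aestronglyMeasurable
  · filter_upwards [ae_pos hsupp] with v hv s hs
    have hs : t / 2 < s := hs
    have hs0 : 0 < s := by linarith
    rw [Real.norm_eq_abs]
    refine (abs_kerR_le (j + 1) hs0 hv).trans ?_
    gcongr
  · refine Filter.Eventually.of_forall fun v s _ => ?_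
    have h1 : HasDerivAt (fun s : ℝ => -(s * v)) (-v) s := by
      simpa using ((hasDerivAt_id' s).mul_const v).fun_neg
    have h2 := ((h1.exp).mul_const v).const_mul ((-v) ^ j)
    have h3 : (-v) ^ j * (Real.exp (-(s * v)) * -v * v) = kerR (j + 1) s v := by
      unfold kerR
      ring
    rw [h3] at h2
    refine h2.congr_of_eventuallyEq (Filter.Eventually.of_forall fun r => ?_)
    simp only [kerR]
    try ring

theorem iteratedDeriv_eq {μ : Measure ℝ} (hsupp : μ {v : ℝ | v ≤ 0} = 0)
    (hd : Integrable (fun v => v) μ) {φ : ℝ → ℂ}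
    (hφ : ∀ t : ℝ, 0 ≤ t → φ t = ((∫ v, Real.exp (-(t * v)) * v ∂μ : ℝ) : ℂ)) (j : ℕ) :
    ∀ t : ℝ, 0 < t → iteratedDeriv j φ t = ((∫ v, kerR j t v ∂μ : ℝ) : ℂ) := by
  induction j with
  | zero =>
    intro t ht
    simp [kerR, hφ t ht.le]
  | succ j ih =>
    intro t ht
    rw [iteratedDeriv_succ]
    have h1 := (kerR_int_hasDerivAt hsupp hd j ht).ofReal_comp
    refine (h1.congr_of_eventuallyEq ?_).deriv
    filter_upwards [Ioi_mem_nhds ht] with s hs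
    exact ih s hs

theorem kerR_int_abs {μ : Measure ℝ} (hsupp : μ {v : ℝ | v ≤ 0} = 0) (j : ℕ) (t : ℝ) :
    ∫ v, |kerR j t v| ∂μ = |∫ v, kerR j t v ∂μ| := by
  have h : ∫ v, kerR j t v ∂μ = (-1) ^ j * ∫ v, |kerR j t v| ∂μ := by
    rw [← integral_const_mul]
    refine integral_congr_ae ?_
    filter_upwards [ae_pos hsupp] with v hv
    rw [abs_kerR j t hv, kerR, neg_pow]
    ring
  rw [h, abs_mul, abs_pow, abs_neg, abs_one, one_pow, one_mul,
    abs_of_nonneg (integral_nonneg fun v => abs_nonneg _)]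

theorem moment_high {μ : Measure ℝ} (hsupp : μ {v : ℝ | v ≤ 0} = 0)
    (hd : Integrable (fun v => v) μ) {φ : ℝ → ℂ} (hφmem : φ ∈ TestSet)
    (hφ : ∀ t : ℝ, 0 ≤ t → φ t = ((∫ v, Real.exp (-(t * v)) * v ∂μ : ℝ) : ℂ)) (j : ℕ) :
    Integrable (fun v : ℝ => v ^ (j + 1)) μ := by
  obtain ⟨C, hC⟩ := hφmem.2 j 0
  have hcov : AECover μ Filter.atTop (fun n : ℕ => Set.Iic ((n : ℝ) + 1)) :=
    aecover_Iic (Filter.tendsto_atTop_add_const_right _ _ tendsto_natCast_atTop_atTop)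
  have hb : ∀ n : ℕ, ∀ᵐ v ∂(μ.restrict (Set.Iic ((n : ℝ) + 1))),
      ‖v ^ (j + 1)‖ ≤ Real.exp 1 * |kerR j (1 / ((n : ℝ) + 1)) v| := by
    intro n
    filter_upwards [ae_restrict_of_ae (ae_pos hsupp), ae_restrict_mem measurableSet_Iic] with v hv hvn
    have hn : (0 : ℝ) < (n : ℝ) + 1 := by positivity
    have hvn : v ≤ (n : ℝ) + 1 := hvn
    rw [abs_kerR _ _ hv, Real.norm_of_nonneg (by positivity)]
    have : (1 : ℝ) ≤ Real.exp 1 * Real.exp (-(1 / ((n : ℝ) + 1) * v)) := by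
      rw [← Real.exp_add]
      apply Real.one_le_exp
      have : 1 / ((n : ℝ) + 1) * v ≤ 1 := by
        rw [one_div_mul_eq_div, div_le_one hn]; exact hvn
      linarith
    calc v ^ (j + 1) = v ^ (j + 1) * 1 := by ring
      _ ≤ v ^ (j + 1) * (Real.exp 1 * Real.exp (-(1 / ((n : ℝ) + 1) * v))) := by gcongr
      _ = _ := by ring
  have hki : ∀ n : ℕ, Integrable (fun v => Real.exp 1 * |kerR j (1 / ((n : ℝ) + 1)) v|) μ :=
    fun n => (kerR_integrable hsupp hd j (by positivity)).abs.const_mul _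
  have hi : ∀ n : ℕ, IntegrableOn (fun v : ℝ => v ^ (j + 1)) (Set.Iic ((n : ℝ) + 1)) μ := fun n =>
    Integrable.mono' (hki n).restrict (by fun_prop) (hb n)
  refine hcov.integrable_of_integral_norm_bounded (Real.exp 1 * C) hi
    (Filter.Eventually.of_forall fun n => ?_)
  have hn : (0 : ℝ) < 1 / ((n : ℝ) + 1) := by positivity
  calc ∫ v in Set.Iic ((n : ℝ) + 1), ‖v ^ (j + 1)‖ ∂μ
      ≤ ∫ v in Set.Iic ((n : ℝ) + 1), Real.exp 1 * |kerR j (1 / ((n : ℝ) + 1)) v| ∂μ :=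
        integral_mono_ae (hi n).norm (hki n).restrict (hb n)
    _ ≤ ∫ v, Real.exp 1 * |kerR j (1 / ((n : ℝ) + 1)) v| ∂μ :=
        setIntegral_le_integral (hki n) (Filter.Eventually.of_forall fun v => by positivity)
    _ = Real.exp 1 * |∫ v, kerR j (1 / ((n : ℝ) + 1)) v ∂μ| := by
        rw [integral_const_mul, kerR_int_abs hsupp]
    _ ≤ Real.exp 1 * C := by
        gcongr
        have := hC _ hn.le
        rw [iteratedDeriv_eq hsupp hd hφ j _ hn] at this
        simpa using this

theorem moment_low {μ : Measure ℝ} (hsupp : μ {v : ℝ | v ≤ 0} = 0)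
    (hd : Integrable (fun v => v) μ) {φ : ℝ → ℂ} (hφmem : φ ∈ TestSet)
    (hφ : ∀ t : ℝ, 0 ≤ t → φ t = ((∫ v, Real.exp (-(t * v)) * v ∂μ : ℝ) : ℂ)) (m : ℕ) :
    Integrable (fun v : ℝ => v * (v ^ m)⁻¹) μ := by
  let F : ℕ → ℝ → ℝ := fun n v => Real.exp 1 * ((n : ℝ) + 1) ^ m * (Real.exp (-(n * v)) * v)
  have hFi : ∀ n, Integrable (F n) μ := by
    intro n
    refine Integrable.const_mul ?_ _
    refine Integrable.mono' hd (by fun_prop) ?_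
    filter_upwards [ae_pos hsupp] with v hv
    rw [Real.norm_of_nonneg (by positivity)]
    have : Real.exp (-(n * v)) ≤ 1 := Real.exp_le_one_iff.2 (by
      have : 0 ≤ (n : ℝ) * v := by positivity
      linarith)
    nlinarith
  have hF0 : ∀ n, 0 ≤ᵐ[μ] F n := fun n => by
    filter_upwards [ae_pos hsupp] with v hv
    simp only [F, Pi.zero_apply]
    positivity
  -- sum of integrals
  have hsum : Summable (fun n => ∫ v, F n v ∂μ) := by
    obtain ⟨C0, hC0⟩ := hφmem.2 0 0
    obtain ⟨C, hC⟩ := hφmem.2 0 (m + 2)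
    have hs : Summable (fun n : ℕ => (Real.exp 1 * 2 ^ (m + 2) * (C0 + C)) *
        (1 / ((n : ℝ) + 1) ^ 2)) := by
      refine Summable.mul_left _ ?_
      have := (summable_nat_add_iff 1).2 (Real.summable_one_div_nat_pow.2 (one_lt_two))
      simpa using this
    refine Summable.of_nonneg_of_le (fun n => integral_nonneg_of_ae (hF0 n)) (fun n => ?_) hs
    have hint : ∫ v, F n v ∂μ = Real.exp 1 * ((n : ℝ) + 1) ^ m * ∫ v, Real.exp (-(n * v)) * v ∂μ :=
      integral_const_mul _ _
    set I : ℝ := ∫ v, Real.exp (-(n * v)) * v ∂μ with hI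
    have hn0 : (0 : ℝ) ≤ n := by positivity
    have c0 := hC0 n hn0
    have c1 := hC n hn0
    rw [iteratedDeriv_zero, hφ n hn0, ← hI, Complex.norm_real, Real.norm_eq_abs] at c0 c1
    have hp : ((n : ℝ) + 1) ^ (m + 2) ≤ 2 ^ (m + 2) * (1 + (n : ℝ) ^ (m + 2)) := by
      rcases Nat.eq_zero_or_pos n with rfl | h
      · simp
        exact one_le_pow₀ (by norm_num)
      · have h1 : (1 : ℝ) ≤ n := by exact_mod_cast h
        calc ((n : ℝ) + 1) ^ (m + 2) ≤ (2 * n) ^ (m + 2) := by gcongr; linarith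
          _ = 2 ^ (m + 2) * (n : ℝ) ^ (m + 2) := by rw [mul_pow]
          _ ≤ _ := by gcongr; linarith
    have hbd : ((n : ℝ) + 1) ^ (m + 2) * |I| ≤ 2 ^ (m + 2) * (C0 + C) := by
      calc ((n : ℝ) + 1) ^ (m + 2) * |I| ≤ 2 ^ (m + 2) * (1 + (n : ℝ) ^ (m + 2)) * |I| := by gcongr
        _ = 2 ^ (m + 2) * ((n : ℝ) ^ 0 * |I| + (n : ℝ) ^ (m + 2) * |I|) := by ring
        _ ≤ _ := by gcongr
    rw [hint, mul_one_div, le_div_iff₀ (by positivity)]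
    calc Real.exp 1 * ((n : ℝ) + 1) ^ m * I * ((n : ℝ) + 1) ^ 2
        = Real.exp 1 * (((n : ℝ) + 1) ^ (m + 2) * I) := by ring
      _ ≤ Real.exp 1 * (((n : ℝ) + 1) ^ (m + 2) * |I|) := by gcongr; exact le_abs_self _
      _ ≤ Real.exp 1 * (2 ^ (m + 2) * (C0 + C)) := by gcongr
      _ = _ := by ring
  have hmeas : AEStronglyMeasurable (fun v : ℝ => v * (v ^ m)⁻¹) μ :=
    Measurable.aestronglyMeasurable (by fun_prop)
  have h0 : 0 ≤ᵐ[μ] (fun v : ℝ => v * (v ^ m)⁻¹) := by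
    filter_upwards [ae_pos hsupp] with v hv
    simp only [Pi.zero_apply]
    positivity
  refine (lintegral_ofReal_ne_top_iff_integrable hmeas h0).1 (ne_of_lt ?_)
  calc ∫⁻ v, ENNReal.ofReal (v * (v ^ m)⁻¹) ∂μ
      ≤ ∫⁻ v, ∑' n, ENNReal.ofReal (F n v) ∂μ := by
        refine lintegral_mono_ae ?_
        filter_upwards [ae_pos hsupp] with v hv
        refine le_trans ?_ (ENNReal.le_tsum ⌊1 / v⌋₊)
        apply ENNReal.ofReal_le_ofReal
        set n := ⌊1 / v⌋₊
        have h1 : (n : ℝ) ≤ 1 / v := Nat.floor_le (by positivity)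
        have h2 : 1 / v < (n : ℝ) + 1 := Nat.lt_floor_add_one _
        have h3 : (n : ℝ) * v ≤ 1 := by rwa [le_div_iff₀ hv] at h1
        have h4 : (1 : ℝ) ≤ Real.exp 1 * Real.exp (-(n * v)) := by
          rw [← Real.exp_add]
          exact Real.one_le_exp (by linarith)
        have h5 : (v ^ m)⁻¹ ≤ ((n : ℝ) + 1) ^ m := by
          rw [← inv_pow, ← one_div]
          gcongr
        calc v * (v ^ m)⁻¹ = 1 * (v * (v ^ m)⁻¹) := by ring
          _ ≤ (Real.exp 1 * Real.exp (-(n * v))) * (v * ((n : ℝ) + 1) ^ m) := by gcongr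
          _ = F n v := by simp only [F]; ring
    _ = ∑' n, ∫⁻ v, ENNReal.ofReal (F n v) ∂μ :=
        lintegral_tsum (fun n => (hFi n).aestronglyMeasurable.aemeasurable.ennreal_ofReal)
    _ = ∑' n, ENNReal.ofReal (∫ v, F n v ∂μ) := by
        congr 1; funext n
        rw [ofReal_integral_eq_lintegral_ofReal (hFi n) (hF0 n)]
    _ < ⊤ := hsum.tsum_ofReal_lt_top

theorem HH_integrable {μ : Measure ℝ} (hsupp : μ {v : ℝ | v ≤ 0} = 0)
    (hd : Integrable (fun v => v) μ) {φ : ℝ → ℂ} (hφmem : φ ∈ TestSet)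
    (hφ : ∀ t : ℝ, 0 ≤ t → φ t = ((∫ v, Real.exp (-(t * v)) * v ∂μ : ℝ) : ℂ)) (k : ℕ) :
    Integrable (HH k) μ := by
  have hm : AEStronglyMeasurable (HH k) μ := by
    rw [← restrict_pos hsupp]
    have : SecondCountableTopologyEither ℝ (EE k) := ⟨Or.inl inferInstance⟩
    exact ContinuousOn.aestronglyMeasurable (β := EE k) (HH_contOn k) measurableSet_Ioi
  refine Integrable.mono' (((moment_high hsupp hd hφmem hφ k).add
    (moment_low hsupp hd hφmem hφ k)).const_mul (k.factorial : ℝ)) hm ?_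
  filter_upwards [ae_pos hsupp] with v hv
  exact HH_bound k hv

theorem dist_integral {μ : Measure ℝ} (hsupp : μ {v : ℝ | v ≤ 0} = 0)
    (hd : Integrable (fun v => v) μ) {φ : ℝ → ℂ} (hφmem : φ ∈ TestSet)
    (hφ : ∀ t : ℝ, 0 ≤ t → φ t = ((∫ v, Real.exp (-(t * v)) * v ∂μ : ℝ) : ℂ))
    (ξ : (ℝ → ℂ) → ℂ) (hξ : IsTemperedDistRplus ξ) :
    ξ φ = ∫ u, (u : ℂ) * ξ (expFun u) ∂μ := by
  obtain ⟨k, g, hg⟩ := exists_extension ξ hξ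
  have hi := HH_integrable hsupp hd hφmem hφ k
  have he : ∫ u, HH k u ∂μ = emb k ⟨φ, hφmem⟩ := by
    ext p t
    let L : EE k →L[ℂ] ℂ := (BoundedContinuousFunction.evalCLM ℂ t).comp
      (ContinuousLinearMap.proj (R := ℂ)
        (φ := fun _ : Fin (k + 1) × Fin (k + 1) =>
          BoundedContinuousFunction (Set.Ioi (0 : ℝ)) ℂ) p)
    have hL : ∀ e : EE k, L e = e p t := fun e => rfl
    rw [← hL, ← L.integral_comp_comm hi, emb_apply, iteratedDeriv_eq hsupp hd hφ p.1 t t.2,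
      ← Complex.ofReal_pow, ← Complex.ofReal_mul, ← integral_const_mul, ← integral_complex_ofReal]
    refine integral_congr_ae ?_
    filter_upwards [ae_pos hsupp] with v hv
    rw [hL, HH_apply k hv]
  have h1 := hg ⟨φ, hφmem⟩
  rw [← he, ← g.integral_comp_comm hi] at h1
  rw [← h1]
  refine integral_congr_ae ?_
  filter_upwards [ae_pos hsupp] with v hv
  rw [HH, map_smul, hg, expT_val hv, smul_eq_mul]

theorem trace_aux
    (tr : (X →L[ℂ] X) → ℂ)
    (htr_add : ∀ S R : X →L[ℂ] X, IsNuclear S → IsNuclear R → tr (S + R) = tr S + tr R)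
    (htr_smul : ∀ (c : ℂ) (S : X →L[ℂ] X), IsNuclear S → tr (c • S) = c * tr S)
    (htr_norm : ∀ S : X →L[ℂ] X, IsNuclear S → ‖tr S‖ ≤ nuclearNorm S)
    {μ : Measure ℝ} {R : ℝ → Nuc X} (hR : Integrable R μ) :
    tr (Nuc.val (∫ u, R u ∂μ)) = ∫ u, tr (Nuc.val (R u)) ∂μ := by
  let trL : Nuc X →L[ℂ] ℂ := LinearMap.mkContinuous
    { toFun := fun S => tr (Nuc.val S)
      map_add' := fun S R => by
        rw [map_add]; exact htr_add _ _ (Nuc.isNuclear S) (Nuc.isNuclear R)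
      map_smul' := fun c S => by
        rw [map_smul]; exact htr_smul _ _ (Nuc.isNuclear S) } 1
    (fun S => by
      rw [one_mul, Nuc.norm_def]
      exact htr_norm _ (Nuc.isNuclear S))
  exact (trL.integral_comp_comm hR).symm

/-- **Corollary 13.** In the setting of Theorem 8 (approximation property, trace `tr`
on nuclear operators, bounded holomorphic semigroups `T_A`, `T_B` with nuclear
difference of generators), let `ξ` be the associated tempered distribution supported
in `ℝ₊`, whose Laplace transform is `z ↦ tr((T_A(z) - T_B(z))/z)`.  Let `ψ ∈ 𝒯₁`
with representing measure `μ` and `ψ'(-0) ≠ ∞`.  If, in addition, the function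
`t ↦ ψ'(-t) = ∫ e^{-ut} u dμ(u)` belongs to the test space `𝒮_{ℝ₊}` (i.e. it is the
restriction to `ℝ₊` of some `φ ∈ 𝒮_{ℝ₊}`), then `tr(ψ(A) - ψ(B)) = ⟨ξ(t), ψ'(-t)⟩`. -/
theorem trace_formula_test_function (hAP : ApproxProperty X)
    (tr : (X →L[ℂ] X) → ℂ)
    (htr_add : ∀ S R : X →L[ℂ] X, IsNuclear S → IsNuclear R → tr (S + R) = tr S + tr R)
    (htr_smul : ∀ (c : ℂ) (S : X →L[ℂ] X), IsNuclear S → tr (c • S) = c * tr S)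
    (htr_norm : ∀ S : X →L[ℂ] X, IsNuclear S → ‖tr S‖ ≤ nuclearNorm S)
    (htr_rank1 : ∀ (f : X →L[ℂ] ℂ) (y : X), tr (f.smulRight y) = f y)
    (A B : HoloGen X) (M : ℝ)
    (hMA : ∀ z : ℂ, 0 < z.re → ‖A.T z‖ ≤ M)
    (hMB : ∀ z : ℂ, 0 < z.re → ‖B.T z‖ ≤ M)
    (hdom : A.dom = B.dom) (hdense : Dense (A.dom : Set X))
    (Δ : X →L[ℂ] X) (hΔ : ∀ x ∈ A.dom, Δ x = A.gen x - B.gen x)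
    (hΔnuc : IsNuclear Δ)
    (ξ : (ℝ → ℂ) → ℂ) (hξ : IsTemperedDistRplus ξ)
    (hLaplace : ∀ z : ℂ, 0 < z.re →
      ξ (fun t => Complex.exp (-(z * (t : ℂ)))) = tr (z⁻¹ • (A.T z - B.T z)))
    (μ : Measure ℝ) (hsupp : μ {v : ℝ | v ≤ 0} = 0)
    (hint : ∀ s : ℝ, s < 0 → Integrable (fun v => Real.exp (s * v) - 1) μ)
    (hd : Integrable (fun v => v) μ)
    (D : X →L[ℂ] X)
    (hD : ∀ x ∈ A.dom, D x = ∫ u, (A.T (u : ℂ) x - B.T (u : ℂ) x) ∂μ)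
    (φ : ℝ → ℂ) (hφmem : φ ∈ TestSet)
    (hφ : ∀ t : ℝ, 0 ≤ t → φ t = ((∫ v, Real.exp (-(t * v)) * v ∂μ : ℝ) : ℂ)) :
    tr D = ξ φ := by
  have hval : Nuc.val (Nuc.mk Δ hΔnuc) = Δ := Nuc.val_mk Δ hΔnuc
  have hΔ' : ∀ x ∈ A.dom, Nuc.val (Nuc.mk Δ hΔnuc) x = A.gen x - B.gen x := by
    rw [hval]; exact hΔ
  generalize Nuc.mk Δ hΔnuc = N at hΔ'
  have hRint : Integrable (diffNuc A B N) μ := by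
    have hm : AEStronglyMeasurable (diffNuc A B N) μ := by
      rw [← restrict_pos hsupp]
      exact (diffNuc_contOn A B M hMA hMB N).aestronglyMeasurable measurableSet_Ioi
    refine Integrable.mono' (hd.const_mul (M * M * ‖N‖)) hm ?_
    filter_upwards [ae_pos hsupp] with u hu
    exact diffNuc_bound A B M hMA hMB N hu
  have hv : ∀ u : ℝ, 0 < u → Nuc.val (diffNuc A B N u) = A.T (u : ℂ) - B.T (u : ℂ) :=
    fun u hu => diffNuc_val A B M hMA hMB N hdom hΔ' hu
  have hDeq : D = Nuc.val (∫ u, diffNuc A B N u ∂μ) := by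
    have : (D : X → X) = Nuc.val (∫ u, diffNuc A B N u ∂μ) := by
      refine Continuous.ext_on hdense D.continuous
        (Nuc.val (∫ u, diffNuc A B N u ∂μ)).continuous ?_
      intro x hx
      have h1 := (((ContinuousLinearMap.apply ℂ X) x).comp
        (Nuc.incl (X := X))).integral_comp_comm hRint
      have h2 : Nuc.val (∫ u, diffNuc A B N u ∂μ) x
          = ∫ u, Nuc.val (diffNuc A B N u) x ∂μ := h1.symm
      rw [h2, hD x hx]
      refine integral_congr_ae ?_
      filter_upwards [ae_pos hsupp] with u hu
      rw [hv u hu]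
      rfl
    exact DFunLike.coe_injective this
  rw [hDeq, trace_aux tr htr_add htr_smul htr_norm hRint,
    dist_integral hsupp hd hφmem hφ ξ hξ]
  refine integral_congr_ae ?_
  filter_upwards [ae_pos hsupp] with u hu
  have h3 := hLaplace (u : ℂ) (by simpa using hu)
  have h4 : ξ (expFun u) = tr ((u : ℂ)⁻¹ • (A.T (u : ℂ) - B.T (u : ℂ))) := h3
  have h5 : IsNuclear (A.T (u : ℂ) - B.T (u : ℂ)) := by
    rw [← hv u hu]; exact Nuc.isNuclear _
  have hu0 : (u : ℂ) ≠ 0 := by exact_mod_cast hu.ne'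
  rw [h4, htr_smul _ _ h5, mul_inv_cancel_left₀ hu0, hv u hu]
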